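/- Lemma (periodic approximation of the critical orbit). Let f ∈ Bimod, set 𝕀⁺ = π([c̃⁺, d̃⁺]), and let q_k⁺ be the continued-fraction denominators of ρ⁺. Then for every sufficiently large k ∈ ℕ there exists a point b⁺ ∈ 𝕀⁺ which is periodic for f with period q⁺_{2k}, satisfying f^{q⁺_{2k}}(b⁺) = b⁺ and f^n(b⁺) ∉ 𝕀⁺ for every 1 ≤ n < q⁺_{2k}. -/

import Mathlib

open MeasureTheory Set Filter
open scoped ENNReal

noncomputable section

/-- Iterated fractional parts in the continued fraction algorithm:
`cfFrac ρ 0 = ρ - ⌊ρ⌋` and `cfFrac ρ (k+1) = 1/(cfFrac ρ k) - ⌊1/(cfFrac ρ k)⌋`. -/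
noncomputable def cfFrac (ρ : ℝ) : ℕ → ℝ
  | 0 => Int.fract ρ
  | n + 1 => Int.fract (1 / cfFrac ρ n)

/-- Partial quotients `a_k` of the continued fraction expansion of `ρ`. -/
noncomputable def cfA (ρ : ℝ) : ℕ → ℤ
  | 0 => ⌊ρ⌋
  | n + 1 => ⌊1 / cfFrac ρ n⌋

/-- Denominators `q_k` of the convergents of `ρ`:
`q_0 = 1`, `q_1 = a_1` (since `q_{-1} = 0`), `q_{k+1} = a_{k+1} q_k + q_{k-1}`. -/
noncomputable def cfQ (ρ : ℝ) : ℕ → ℕ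
  | 0 => 1
  | 1 => (cfA ρ 1).toNat
  | n + 2 => (cfA ρ (n + 2)).toNat * cfQ ρ (n + 1) + cfQ ρ n
/-- The class `Bimod` of degree one bimodal circle endomorphisms, given by the
circle map `f : 𝕋¹ → 𝕋¹` together with a lift `F : ℝ → ℝ` (`π ∘ F = f ∘ π`,
`F(x+1) = F(x)+1`), satisfying (A1) (`C²`, bimodal with non-flat critical points
`c̃⁺ < c̃⁻` of orders `ℓ⁺, ℓ⁻`), (A2) (the rotation numbers of the upper and lower
maps `F₊, F₋` are irrational) and (A3) (all periodic orbits are hyperbolic repelling). -/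
structure BimodData where
  /-- the lift -/
  F : ℝ → ℝ
  /-- the circle endomorphism -/
  f : UnitAddCircle → UnitAddCircle
  /-- lift of the critical point `c⁺` -/
  ctp : ℝ
  /-- lift of the critical point `c⁻` -/
  ctm : ℝ
  /-- `d̃⁺`, the second preimage of the critical value of `c⁺` -/
  dtp : ℝ
  /-- `d̃⁻`, the second preimage of the critical value of `c⁻` -/
  dtm : ℝ
  /-- the non-flatness order `ℓ⁺` -/
  lp : ℝ
  /-- the non-flatness order `ℓ⁻` -/
  lm : ℝ
  /-- the upper map `F₊` (a monotone degree one lift) -/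
  Fp : CircleDeg1Lift
  /-- the lower map `F₋` (a monotone degree one lift) -/
  Fm : CircleDeg1Lift
  /-- the diffeomorphism `ψ⁺` -/
  psip : ℝ → ℝ
  /-- the diffeomorphism `ψ⁻` -/
  psim : ℝ → ℝ
  hf : ∀ x : ℝ, f ((x : ℝ) : UnitAddCircle) = ((F x : ℝ) : UnitAddCircle)
  h0 : 0 < ctp
  h1 : ctp < ctm
  h2 : ctm < 1
  hlift : ∀ x, F (x + 1) = F x + 1
  hC2 : ContDiff ℝ 2 F
  hdecr : ∀ x ∈ Set.Ioo ctp ctm, deriv F x < 0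
  hincr : ∀ x ∈ Set.Ioo ctm (ctp + 1), 0 < deriv F x
  hlp : 1 < lp
  hlm : 1 < lm
  hpsipC2 : ContDiff ℝ 2 psip
  hpsipBij : Function.Bijective psip
  hpsipD : ∀ x, deriv psip x ≠ 0
  hpsip0 : psip ctp = 0
  hpsipEq : ∀ᶠ x in nhds ctp, F x = F ctp - |psip x| ^ lp
  hpsimC2 : ContDiff ℝ 2 psim
  hpsimBij : Function.Bijective psim
  hpsimD : ∀ x, deriv psim x ≠ 0
  hpsim0 : psim ctm = 0
  hpsimEq : ∀ᶠ x in nhds ctm, F x = F ctm + |psim x| ^ lm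
  hdtp : dtp ∈ Set.Ioo ctm (ctp + 1)
  hdtpF : F dtp = F ctp
  hFp1 : ∀ x ∈ Set.Icc ctp dtp, Fp x = F ctp
  hFp2 : ∀ x ∈ Set.Icc dtp (ctp + 1), Fp x = F x
  hdtm : dtm ∈ Set.Ioo (ctm - 1) ctp
  hdtmF : F dtm = F ctm
  hFm1 : ∀ x ∈ Set.Icc dtm ctm, Fm x = F ctm
  hFm2 : ∀ x ∈ Set.Icc ctm (dtm + 1), Fm x = F x
  hirrp : Irrational Fp.translationNumber
  hirrm : Irrational Fm.translationNumber
  hA3 : ∀ (x : ℝ) (n : ℕ), 1 ≤ n → (∃ m : ℤ, F^[n] x = x + (m : ℝ)) →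
    1 < |deriv (F^[n]) x|

namespace BimodData

/-- The critical point `c⁺ = π(c̃⁺)`. -/
noncomputable def cp (B : BimodData) : UnitAddCircle := ((B.ctp : ℝ) : UnitAddCircle)

/-- The critical point `c⁻ = π(c̃⁻)`. -/
noncomputable def cm (B : BimodData) : UnitAddCircle := ((B.ctm : ℝ) : UnitAddCircle)

/-- The interval `𝕀 = π([c̃⁺, c̃⁻])` on which `f` is decreasing. -/
def II (B : BimodData) : Set UnitAddCircle :=
  (fun x : ℝ => ((x : ℝ) : UnitAddCircle)) '' Set.Icc B.ctp B.ctm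

/-- The upper rotation number `ρ⁺`. -/
noncomputable def rhop (B : BimodData) : ℝ := B.Fp.translationNumber

/-- The lower rotation number `ρ⁻`. -/
noncomputable def rhom (B : BimodData) : ℝ := B.Fm.translationNumber

/-- Condition (C⁻): `Σ_{k≥0} q⁻_{2k+1} · d(f^{q⁻_{2k}}(c⁻), c⁻) < ∞`. -/
def CondCm (B : BimodData) : Prop :=
  Summable fun k : ℕ =>
    (cfQ B.rhom (2 * k + 1) : ℝ) * dist (B.f^[cfQ B.rhom (2 * k)] B.cm) B.cm

/-- Condition (C⁺): `Σ_{k≥1} q⁺_{2k} · d(f^{q⁺_{2k-1}}(c⁺), c⁺) < ∞`. -/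
def CondCp (B : BimodData) : Prop :=
  Summable fun k : ℕ =>
    (cfQ B.rhop (2 * k + 2) : ℝ) * dist (B.f^[cfQ B.rhop (2 * k + 1)] B.cp) B.cp

end BimodData

/-- The interval `𝕀⁺ = π([c̃⁺, d̃⁺])`. -/
def BimodData.IIp (B : BimodData) : Set UnitAddCircle :=
  (fun x : ℝ => ((x : ℝ) : UnitAddCircle)) '' Set.Icc B.ctp B.dtp

/-- Numerators of the convergents of `ρ`. -/
noncomputable def cfP (ρ : ℝ) : ℕ → ℤ
  | 0 => cfA ρ 0
  | 1 => cfA ρ 1 * cfA ρ 0 + 1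
  | n + 2 => cfA ρ (n + 2) * cfP ρ (n + 1) + cfP ρ n

/-- The signed error `q_n ρ - p_n` of the `n`-th convergent. -/
noncomputable def cfErr (ρ : ℝ) (n : ℕ) : ℝ := cfQ ρ n * ρ - cfP ρ n

lemma irrational_cfFrac {ρ : ℝ} (hρ : Irrational ρ) (n : ℕ) : Irrational (cfFrac ρ n) := by
  induction n with
  | zero => exact hρ.sub_intCast ⌊ρ⌋
  | succ n ih =>
    have h : Irrational (1 / cfFrac ρ n) := by simpa using ih.inv
    exact h.sub_intCast ⌊1 / cfFrac ρ n⌋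

lemma cfFrac_lt_one (ρ : ℝ) (n : ℕ) : cfFrac ρ n < 1 := by
  cases n <;> exact Int.fract_lt_one _

lemma cfFrac_pos {ρ : ℝ} (hρ : Irrational ρ) (n : ℕ) : 0 < cfFrac ρ n := by
  have h : 0 ≤ cfFrac ρ n := by cases n <;> exact Int.fract_nonneg _
  exact lt_of_le_of_ne h (irrational_cfFrac hρ n).ne_zero.symm

lemma cfA_succ_pos {ρ : ℝ} (hρ : Irrational ρ) (n : ℕ) : 1 ≤ cfA ρ (n + 1) := by
  have h0 := cfFrac_pos hρ n
  have h1 := cfFrac_lt_one ρ n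
  rw [cfA, Int.le_floor]
  rw [Int.cast_one, le_div_iff₀ h0]
  linarith

lemma cfFrac_succ (ρ : ℝ) (n : ℕ) : cfFrac ρ (n + 1) = 1 / cfFrac ρ n - cfA ρ (n + 1) := rfl

lemma cast_toNat_cfA_succ {ρ : ℝ} (hρ : Irrational ρ) (n : ℕ) :
    ((cfA ρ (n + 1)).toNat : ℤ) = cfA ρ (n + 1) :=
  Int.toNat_of_nonneg (by linarith [cfA_succ_pos hρ n])

lemma cfQ_one {ρ : ℝ} (hρ : Irrational ρ) : (cfQ ρ 1 : ℤ) = cfA ρ 1 := by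
  rw [cfQ, cast_toNat_cfA_succ hρ]

lemma cfQ_add_two {ρ : ℝ} (hρ : Irrational ρ) (n : ℕ) :
    (cfQ ρ (n + 2) : ℤ) = cfA ρ (n + 2) * cfQ ρ (n + 1) + cfQ ρ n := by
  rw [cfQ]
  push_cast
  rw [← cast_toNat_cfA_succ hρ (n + 1)]
  simp

lemma cfQ_pos {ρ : ℝ} (hρ : Irrational ρ) (n : ℕ) : 1 ≤ cfQ ρ n ∧ 1 ≤ cfQ ρ (n + 1) := by
  induction n with
  | zero =>
    have h1 := cfQ_one hρ
    have h2 := cfA_succ_pos hρ 0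
    refine ⟨le_rfl, ?_⟩
    simp only [zero_add] at *
    omega
  | succ n ih =>
    refine ⟨ih.2, ?_⟩
    rw [cfQ]
    omega

lemma le_cfQ {ρ : ℝ} (hρ : Irrational ρ) (n : ℕ) : n ≤ cfQ ρ n ∧ n + 1 ≤ cfQ ρ (n + 1) := by
  induction n with
  | zero => exact ⟨zero_le, (cfQ_pos hρ 0).2⟩
  | succ n ih =>
    refine ⟨ih.2, ?_⟩
    have h1 := cfA_succ_pos hρ (n + 1)
    have h2 := cfQ_add_two hρ n
    have h3 := (cfQ_pos hρ n).1
    have h4 := ih.2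
    zify at *
    nlinarith

lemma cfErr_succ {ρ : ℝ} (hρ : Irrational ρ) (n : ℕ) :
    cfErr ρ (n + 1) = - cfErr ρ n * cfFrac ρ (n + 1) := by
  induction n with
  | zero =>
    have h0 := (cfFrac_pos hρ 0).ne'
    have h1 : (cfQ ρ 1 : ℝ) = cfA ρ 1 := by exact_mod_cast cfQ_one hρ
    have h2 : cfFrac ρ 0 = ρ - cfA ρ 0 := rfl
    have h3 : (cfP ρ 1 : ℝ) = cfA ρ 1 * cfA ρ 0 + 1 := by simp [cfP]
    have h4 : cfErr ρ 0 = cfFrac ρ 0 := by simp [cfErr, cfQ, cfP, h2]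
    rw [h4, cfFrac_succ, cfErr, h1, h3]
    field_simp
    rw [h2]
    ring
  | succ n ih =>
    have h0 := (cfFrac_pos hρ (n + 1)).ne'
    have h1 : (cfQ ρ (n + 2) : ℝ) = cfA ρ (n + 2) * cfQ ρ (n + 1) + cfQ ρ n := by
      exact_mod_cast cfQ_add_two hρ n
    have h3 : (cfP ρ (n + 2) : ℝ) = cfA ρ (n + 2) * cfP ρ (n + 1) + cfP ρ n := by simp [cfP]
    have h4 : cfErr ρ (n + 2) = cfA ρ (n + 2) * cfErr ρ (n + 1) + cfErr ρ n := by
      simp only [cfErr, h1, h3]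
      ring
    have h5 : cfErr ρ n = - cfErr ρ (n + 1) / cfFrac ρ (n + 1) := by
      rw [ih]
      field_simp
    rw [h4, cfFrac_succ ρ (n + 1), h5]
    ring

lemma cfErr_pos_neg {ρ : ℝ} (hρ : Irrational ρ) (k : ℕ) :
    0 < cfErr ρ (2 * k) ∧ cfErr ρ (2 * k + 1) < 0 := by
  have step (n : ℕ) : cfErr ρ (n + 1) = - cfErr ρ n * cfFrac ρ (n + 1) := cfErr_succ hρ n
  have pos (n : ℕ) := cfFrac_pos hρ n
  induction k with
  | zero =>
    have h : 0 < cfErr ρ 0 := by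
      simpa [cfErr, cfQ, cfP, cfA, cfFrac] using (pos 0)
    refine ⟨h, ?_⟩
    have := step 0
    have := pos 1
    simp only [mul_zero, zero_add] at *
    nlinarith
  | succ k ih =>
    have h2 : 0 < cfErr ρ (2 * k + 2) := by
      have := step (2 * k + 1)
      have := pos (2 * k + 2)
      have := ih.2
      simp only [add_assoc, Nat.reduceAdd] at *
      nlinarith
    refine ⟨h2, ?_⟩
    have e : 2 * (k + 1) + 1 = 2 * k + 2 + 1 := by ring
    rw [e, step (2 * k + 2)]
    have := pos (2 * k + 2 + 1)
    nlinarith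

lemma cfErr_mul_succ_neg {ρ : ℝ} (hρ : Irrational ρ) (n : ℕ) :
    cfErr ρ n * cfErr ρ (n + 1) < 0 := by
  have h := cfErr_pos_neg hρ
  obtain ⟨k, rfl | rfl⟩ := Nat.even_or_odd' n
  · exact mul_neg_of_pos_of_neg (h k).1 (h k).2
  · exact mul_neg_of_neg_of_pos (h k).2 (h (k + 1)).1

lemma abs_cfErr_succ_lt {ρ : ℝ} (hρ : Irrational ρ) (n : ℕ) :
    |cfErr ρ (n + 1)| < |cfErr ρ n| := by
  have h := cfErr_mul_succ_neg hρ n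
  have h0 : 0 < |cfErr ρ n| := abs_pos.2 (left_ne_zero_of_mul h.ne)
  rw [cfErr_succ hρ, abs_mul, abs_neg, abs_of_pos (cfFrac_pos hρ (n + 1))]
  nlinarith [cfFrac_lt_one ρ (n + 1)]

/-- The determinant of two consecutive convergents is `±1`. -/
lemma cf_det {ρ : ℝ} (hρ : Irrational ρ) (n : ℕ) :
    (cfP ρ (n + 1) * cfQ ρ n - cfP ρ n * cfQ ρ (n + 1)) ^ 2 = 1 := by
  induction n with
  | zero =>
    have h1 := cfQ_one hρ
    simp only [zero_add, h1, cfP]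
    simp only [cfQ]
    push_cast
    ring
  | succ n ih =>
    rw [cfQ_add_two hρ, cfP]
    linear_combination ih

lemma cfErr_even_le {ρ : ℝ} (hρ : Irrational ρ) (k : ℕ) :
    cfErr ρ (2 * k) ≤ 1 / ((k : ℝ) + 1) := by
  have hE := cfErr_pos_neg hρ k
  have hd := cf_det hρ (2 * k)
  have hq : ((2 * k + 1 : ℕ) : ℝ) ≤ cfQ ρ (2 * k + 1) := by exact_mod_cast (le_cfQ hρ (2 * k)).2
  have hq0 : (0 : ℝ) ≤ cfQ ρ (2 * k) := Nat.cast_nonneg _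
  have hdet : (cfP ρ (2 * k + 1) * cfQ ρ (2 * k) - cfP ρ (2 * k) * cfQ ρ (2 * k + 1) : ℝ) ≤ 1 := by
    have : cfP ρ (2 * k + 1) * cfQ ρ (2 * k) - cfP ρ (2 * k) * cfQ ρ (2 * k + 1) ≤ 1 := by
      nlinarith
    exact_mod_cast this
  have hid : cfQ ρ (2 * k + 1) * cfErr ρ (2 * k) - cfQ ρ (2 * k) * cfErr ρ (2 * k + 1) =
      cfP ρ (2 * k + 1) * cfQ ρ (2 * k) - cfP ρ (2 * k) * cfQ ρ (2 * k + 1) := by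
    simp only [cfErr]
    ring
  rw [le_div_iff₀ (by positivity)]
  push_cast at hq
  have hk : (0 : ℝ) ≤ k := Nat.cast_nonneg _
  nlinarith [hE.1, hE.2]

/-- Convergents are best approximations: `|q_n ρ - p_n| < |j ρ - m|` for `1 ≤ j < q_n`. -/
lemma abs_cfErr_lt_of_lt_cfQ {ρ : ℝ} (hρ : Irrational ρ) (n : ℕ) {j : ℕ} (hj : 1 ≤ j)
    (hjq : j < cfQ ρ (n + 1)) (m : ℤ) : |cfErr ρ (n + 1)| < |j * ρ - m| := by
  obtain ⟨s, hs, hdet⟩ : ∃ s : ℤ, s ^ 2 = 1 ∧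
      cfP ρ (n + 1) * cfQ ρ n - cfP ρ n * cfQ ρ (n + 1) = s := ⟨_, cf_det hρ n, rfl⟩
  set x : ℤ := s * (cfP ρ (n + 1) * j - cfQ ρ (n + 1) * m) with hx
  set y : ℤ := s * (cfQ ρ n * m - cfP ρ n * j) with hy
  have hjxy : (j : ℤ) = x * cfQ ρ n + y * cfQ ρ (n + 1) := by
    rw [hx, hy]
    linear_combination (-(j : ℤ)) * hs - (s * (j : ℤ)) * hdet
  have hmxy : m = x * cfP ρ n + y * cfP ρ (n + 1) := by
    rw [hx, hy]
    linear_combination (-m) * hs - (s * m) * hdet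
  have herr : j * ρ - m = x * cfErr ρ n + y * cfErr ρ (n + 1) := by
    have h1 : (j : ℝ) = x * cfQ ρ n + y * cfQ ρ (n + 1) := by exact_mod_cast hjxy
    have h2 : (m : ℝ) = x * cfP ρ n + y * cfP ρ (n + 1) := by exact_mod_cast hmxy
    rw [h1, h2, cfErr, cfErr]
    ring
  have hQ0 : (1 : ℤ) ≤ cfQ ρ n := by exact_mod_cast (cfQ_pos hρ n).1
  have hQ1 : (1 : ℤ) ≤ cfQ ρ (n + 1) := by exact_mod_cast (cfQ_pos hρ n).2
  have hj' : (1 : ℤ) ≤ j := by exact_mod_cast hj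
  have hjq' : (j : ℤ) < cfQ ρ (n + 1) := by exact_mod_cast hjq
  have hneg := cfErr_mul_succ_neg hρ n
  have hlt := abs_cfErr_succ_lt hρ n
  have hx0 : x ≠ 0 := by
    intro h0
    rw [h0] at hjxy
    have : 0 < y := by nlinarith
    nlinarith
  have hxy : x * y ≤ 0 := by
    by_contra! hpos
    rcases pos_and_pos_or_neg_and_neg_of_mul_pos hpos with ⟨h1, h2⟩ | ⟨h1, h2⟩
    · nlinarith
    · nlinarith
  have habs : |(j : ℝ) * ρ - m| = |(x : ℝ)| * |cfErr ρ n| + |(y : ℝ)| * |cfErr ρ (n + 1)| := by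
    have hsign : 0 ≤ (x * cfErr ρ n) * (y * cfErr ρ (n + 1)) := by
      have : (x * y : ℝ) ≤ 0 := by exact_mod_cast hxy
      nlinarith
    rw [herr, ← abs_mul, ← abs_mul]
    exact (abs_add_eq_add_abs_iff _ _).2 (mul_nonneg_iff.1 hsign)
  have hx1 : (1 : ℝ) ≤ |(x : ℝ)| := by exact_mod_cast Int.one_le_abs hx0
  rw [habs]
  nlinarith [abs_nonneg (cfErr ρ n), mul_nonneg (abs_nonneg (y : ℝ)) (abs_nonneg (cfErr ρ (n + 1)))]

/-- `h` is a monotone degree one map conjugating `G` to the translation by its translation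
number. -/
structure IsRotationSemiconj (G : CircleDeg1Lift) (h : ℝ → ℝ) : Prop where
  monotone : Monotone h
  map_add_one : ∀ x, h (x + 1) = h x + 1
  map_apply : ∀ x, h (G x) = h x + G.translationNumber

lemma CircleDeg1Lift.abs_iterate_sub_le (G : CircleDeg1Lift) (x : ℝ) (n : ℕ) :
    |G^[n] x - n * G.translationNumber| ≤ |x| + 1 := by
  have h1 := (G ^ n).map_lt_add_translationNumber_add_one x
  have h2 := (G ^ n).translationNumber_le_ceil_sub x
  have h3 := Int.ceil_lt_add_one ((G ^ n) x - x)
  rw [G.translationNumber_pow] at h1 h2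
  rw [G.coe_pow] at h1 h2 h3
  have := neg_abs_le x
  have := le_abs_self x
  rw [abs_le]
  constructor <;> linarith

/-- Every lift is semiconjugate to a translation by a monotone degree one map. -/
lemma exists_isRotationSemiconj (G : CircleDeg1Lift) : ∃ h, IsRotationSemiconj G h := by
  set τ := G.translationNumber with hτ
  set u : ℝ → ℕ → ℝ := fun x n => G^[n] x - n * τ with hu
  have hb (x : ℝ) (n : ℕ) : |u x n| ≤ |x| + 1 := G.abs_iterate_sub_le x n
  have hle (x : ℝ) : atTop.IsBoundedUnder (· ≤ ·) (u x) :=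
    isBoundedUnder_of ⟨|x| + 1, fun n => (abs_le.1 (hb x n)).2⟩
  have hge (x : ℝ) : atTop.IsBoundedUnder (· ≥ ·) (u x) :=
    isBoundedUnder_of ⟨-(|x| + 1), fun n => (abs_le.1 (hb x n)).1⟩
  have hco (x : ℝ) : atTop.IsCoboundedUnder (· ≤ ·) (u x) := (hge x).isCoboundedUnder_le
  refine ⟨fun x => limsup (u x) atTop, fun x y hxy => ?_, fun x => ?_, fun x => ?_⟩
  · refine limsup_le_limsup (Eventually.of_forall fun n => ?_) (hco x) (hle y)
    exact sub_le_sub_right (G.monotone.iterate n hxy) _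
  · rw [← limsup_add_const atTop (u x) 1 (hle x) (hco x)]
    congr 1
    funext n
    have := (G ^ n).map_add_one x
    rw [G.coe_pow] at this
    simp only [hu, this]
    ring
  · rw [← limsup_add_const atTop (u x) τ (hle x) (hco x)]
    have := limsup_nat_add (fun n => u x n + τ) 1
    rw [← this]
    congr 1
    funext n
    simp only [hu, Function.iterate_succ_apply]
    push_cast
    ring

namespace IsRotationSemiconj

variable {G : CircleDeg1Lift} {h : ℝ → ℝ}

lemma map_add_int (H : IsRotationSemiconj G h) (x : ℝ) (m : ℤ) : h (x + m) = h x + m := by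
  let g : CircleDeg1Lift := ⟨⟨h, H.monotone⟩, H.map_add_one⟩
  exact g.map_add_int x m

lemma map_iterate (H : IsRotationSemiconj G h) (n : ℕ) (x : ℝ) :
    h (G^[n] x) = h x + n * G.translationNumber := by
  induction n with
  | zero => simp
  | succ n ih =>
    rw [Function.iterate_succ_apply', H.map_apply, ih]
    push_cast
    ring

lemma lt_of_map_lt (H : IsRotationSemiconj G h) {x y : ℝ} (hxy : h x < h y) : x < y :=
  lt_of_not_ge fun hle => hxy.not_ge (H.monotone hle)

end IsRotationSemiconj

/-- Pairwise disjoint compact intervals in an interval of length one have total length at most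
one. -/
lemma sum_sub_le_one_of_disjoint {a : ℝ} {N : ℕ} {x y : ℕ → ℝ} (hxy : ∀ i < N, x i ≤ y i)
    (hax : ∀ i < N, a ≤ x i) (hya : ∀ i < N, y i ≤ a + 1)
    (hd : ∀ i < N, ∀ j < N, i < j → Disjoint (Icc (x i) (y i)) (Icc (x j) (y j))) :
    ∑ i ∈ Finset.range N, (y i - x i) ≤ 1 := by
  have hd' : Set.PairwiseDisjoint (↑(Finset.range N)) fun i => Icc (x i) (y i) := by
    intro i hi j hj hij
    simp only [Finset.coe_range, mem_Iio] at hi hj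
    rcases lt_or_gt_of_ne hij with h | h
    · exact hd i hi j hj h
    · exact (hd j hj i hi h).symm
  have hm := measure_biUnion_finset (μ := volume) hd' fun i _ => measurableSet_Icc
  have hs : (⋃ i ∈ Finset.range N, Icc (x i) (y i)) ⊆ Icc a (a + 1) := by
    refine iUnion₂_subset fun i hi => Icc_subset_Icc (hax i ?_) (hya i ?_) <;> simpa using hi
  have hle := measure_mono (μ := volume) hs
  rw [hm] at hle
  simp only [Real.volume_Icc] at hle
  rw [← ENNReal.ofReal_sum_of_nonneg] at hle
  · rw [add_sub_cancel_left] at hle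
    exact (ENNReal.ofReal_le_ofReal_iff zero_le_one).1 hle
  · intro i hi
    exact sub_nonneg.2 (hxy i (by simpa using hi))

namespace BimodData

lemma map_add_int (B : BimodData) (x : ℝ) (m : ℤ) : B.F (x + m) = B.F x + m := by
  have hper : Function.Periodic (fun x => B.F x - x) 1 := fun x => by
    simp only [B.hlift]
    ring
  have := hper.int_mul m x
  simp only [mul_one] at this
  linarith

lemma differentiable (B : BimodData) : Differentiable ℝ B.F :=
  B.hC2.differentiable (by norm_num)

lemma deriv_add_int (B : BimodData) (x : ℝ) (m : ℤ) : deriv B.F (x + m) = deriv B.F x := by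
  have h : (fun y => B.F (y + m)) = fun y => B.F y + m := funext fun y => B.map_add_int y m
  have h1 := congrArg (fun g => deriv g x) h
  simpa [deriv_comp_add_const] using h1

lemma strictMonoOn (B : BimodData) : StrictMonoOn B.F (Icc B.ctm (B.ctp + 1)) := by
  refine strictMonoOn_of_deriv_pos (convex_Icc _ _) B.differentiable.continuous.continuousOn ?_
  rw [interior_Icc]
  exact B.hincr

lemma strictAntiOn (B : BimodData) : StrictAntiOn B.F (Icc B.ctp B.ctm) := by
  refine strictAntiOn_of_deriv_neg (convex_Icc _ _) B.differentiable.continuous.continuousOn ?_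
  rw [interior_Icc]
  exact B.hdecr

lemma map_ctm_lt_map_ctp (B : BimodData) : B.F B.ctm < B.F B.ctp :=
  B.strictAntiOn (left_mem_Icc.2 B.h1.le) (right_mem_Icc.2 B.h1.le) B.h1

lemma ctp_lt_dtp (B : BimodData) : B.ctp < B.dtp := B.h1.trans B.hdtp.1

lemma Fp_ctp (B : BimodData) : B.Fp B.ctp = B.F B.ctp :=
  B.hFp1 _ (left_mem_Icc.2 B.ctp_lt_dtp.le)

lemma Fp_eq_of_mem (B : BimodData) {x : ℝ} {m : ℤ}
    (hx : x ∈ Icc (B.dtp + m) (B.ctp + 1 + m)) : B.Fp x = B.F x := by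
  have h := B.hFp2 (x - m) ⟨by linarith [hx.1], by linarith [hx.2]⟩
  have h2 := B.map_add_int (x - m) m
  rw [B.Fp.map_sub_int] at h
  rw [sub_add_cancel] at h2
  linarith

lemma Fp_surjective (B : BimodData) : Function.Surjective B.Fp := by
  intro y
  set m : ℤ := ⌊y - B.F B.ctp⌋
  have h1 := Int.floor_le (y - B.F B.ctp)
  have h2 := (Int.lt_floor_add_one (y - B.F B.ctp)).le
  have hsub := intermediate_value_Icc B.hdtp.2.le (f := B.F)
    B.differentiable.continuous.continuousOn
  obtain ⟨x, hx, hxy⟩ := hsub (show y - m ∈ Icc (B.F B.dtp) (B.F (B.ctp + 1)) by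
    rw [B.hdtpF, B.hlift]
    exact ⟨by linarith, by linarith⟩)
  refine ⟨x + m, ?_⟩
  rw [B.Fp.map_add_int, B.hFp2 x hx, hxy]
  ring

lemma Fp_continuous (B : BimodData) : Continuous B.Fp :=
  B.Fp.continuous_iff_surjective.2 B.Fp_surjective

/-- An interval avoiding all translates of `[c̃⁺, d̃⁺]` lies in a single gap between them. -/
lemma exists_gap (B : BimodData) {x y : ℝ} (hxy : x ≤ y)
    (hav : ∀ z ∈ Icc x y, ∀ m : ℤ, z ∉ Icc (B.ctp + m) (B.dtp + m)) :
    ∃ m : ℤ, B.dtp + m < x ∧ y < B.ctp + 1 + m := by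
  set m : ℤ := ⌊x - B.ctp⌋
  have h1 := Int.floor_le (x - B.ctp)
  have h2 := Int.lt_floor_add_one (x - B.ctp)
  refine ⟨m, ?_, ?_⟩
  · by_contra! h
    exact hav x (left_mem_Icc.2 hxy) m ⟨by linarith, h⟩
  · by_contra! h
    refine hav (B.ctp + 1 + m) ⟨by linarith, h⟩ (m + 1) ?_
    push_cast
    exact ⟨by linarith, by linarith [B.ctp_lt_dtp]⟩

section Semiconj

variable {B : BimodData} {h : ℝ → ℝ}

lemma map_dtp_eq (H : IsRotationSemiconj B.Fp h) : h B.dtp = h B.ctp := by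
  have h1 := H.map_apply B.ctp
  have h2 := H.map_apply B.dtp
  rw [B.Fp_ctp] at h1
  rw [B.hFp1 _ (right_mem_Icc.2 B.ctp_lt_dtp.le)] at h2
  linarith

lemma map_eq_of_mem (H : IsRotationSemiconj B.Fp h) {z : ℝ} {m : ℤ}
    (hz : z ∈ Icc (B.ctp + m) (B.dtp + m)) : h z = h B.ctp + m := by
  have h1 := H.monotone hz.1
  have h2 := H.monotone hz.2
  rw [H.map_add_int] at h1 h2
  rw [map_dtp_eq H] at h2
  linarith

/-- The orbit of an interval `[s, t]` attached to the critical value stays in the gaps between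
the translates of `[c̃⁺, d̃⁺]`, as long as no integer combination of the rotation number is
smaller than the rotation length of `[s, t]`. -/
lemma exists_gap_iterate (H : IsRotationSemiconj B.Fp h) {s t : ℝ} {N : ℕ} (hst : s ≤ t)
    (hs : h s = h B.ctp + B.rhop)
    (hN : ∀ j : ℕ, 1 ≤ j → j ≤ N → ∀ m : ℤ, h t - h s < |j * B.rhop - m|) {i : ℕ} (hi : i < N) :
    ∃ m : ℤ, B.dtp + m < B.Fp^[i] s ∧ B.Fp^[i] t < B.ctp + 1 + m := by
  refine B.exists_gap (B.Fp.monotone.iterate i hst) fun z hz m hzm => ?_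
  have h1 := H.monotone hz.1
  have h2 := H.monotone hz.2
  rw [map_eq_of_mem H hzm, H.map_iterate] at h1 h2
  have h3 := hN (i + 1) (by omega) (by omega) m
  have h4 : B.rhop = B.Fp.translationNumber := rfl
  push_cast at h3
  rw [lt_abs] at h3
  rw [← h4] at h1 h2
  rcases h3 with h3 | h3 <;> nlinarith

lemma sum_iterate_sub_le_one (H : IsRotationSemiconj B.Fp h) {s t : ℝ} {N : ℕ} (hst : s ≤ t)
    (hs : h s = h B.ctp + B.rhop)
    (hN : ∀ j : ℕ, 1 ≤ j → j ≤ N → ∀ m : ℤ, h t - h s < |j * B.rhop - m|) :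
    ∑ i ∈ Finset.range N, (B.Fp^[i] t - B.Fp^[i] s) ≤ 1 := by
  have hgap : ∀ i : ℕ, ∃ m : ℤ, i < N →
      B.dtp + m < B.Fp^[i] s ∧ B.Fp^[i] t < B.ctp + 1 + m := by
    intro i
    by_cases hi : i < N
    · obtain ⟨m, hm⟩ := exists_gap_iterate H hst hs hN hi
      exact ⟨m, fun _ => hm⟩
    · exact ⟨0, fun hi' => absurd hi' hi⟩
  choose m hm using hgap
  have key := sum_sub_le_one_of_disjoint (a := B.ctp) (N := N)
    (x := fun i => B.Fp^[i] s - m i) (y := fun i => B.Fp^[i] t - m i)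
    (fun i _ => sub_le_sub_right (B.Fp.monotone.iterate i hst) _)
    (fun i hi => by linarith [(hm i hi).1, B.ctp_lt_dtp])
    (fun i hi => by linarith [(hm i hi).2]) ?_
  · simpa using key
  · intro i hi j hj hij
    rw [Set.disjoint_left]
    intro z hzi hzj
    have h1 := H.monotone (show B.Fp^[i] s ≤ z + m i by linarith [hzi.1])
    have h2 := H.monotone (show z + m i ≤ B.Fp^[i] t by linarith [hzi.2])
    have h3 := H.monotone (show B.Fp^[j] s ≤ z + m j by linarith [hzj.1])
    have h4 := H.monotone (show z + m j ≤ B.Fp^[j] t by linarith [hzj.2])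
    rw [H.map_add_int, H.map_iterate] at h1 h2 h3 h4
    have h5 := hN (j - i) (by omega) (by omega) (m j - m i)
    have h6 : B.rhop = B.Fp.translationNumber := rfl
    rw [← h6] at h1 h2 h3 h4
    rw [Nat.cast_sub hij.le, lt_abs] at h5
    push_cast at h5
    rcases h5 with h5 | h5 <;> nlinarith

end Semiconj

end BimodData

/-- A positive `C¹` function on a compact interval has Lipschitz logarithm. -/
lemma exists_le_exp_mul {g : ℝ → ℝ} (hg : ContDiff ℝ 1 g) {a b : ℝ}
    (hpos : ∀ x ∈ Icc a b, 0 < g x) :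
    ∃ C, 0 ≤ C ∧ ∀ x y, a ≤ x → x ≤ y → y ≤ b → g y ≤ Real.exp (C * (y - x)) * g x := by
  rcases lt_or_ge b a with hab | hab
  · exact ⟨0, le_rfl, fun x y h1 h2 h3 => by linarith⟩
  obtain ⟨z, hz, hmin⟩ := isCompact_Icc.exists_isMinOn (nonempty_Icc.2 hab)
    hg.continuous.continuousOn
  obtain ⟨L, hL⟩ := isCompact_Icc.exists_bound_of_continuousOn (s := Icc a b)
    (hg.continuous_deriv le_rfl).continuousOn
  have hL0 : 0 ≤ L := (norm_nonneg _).trans (hL z hz)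
  have hgz := hpos z hz
  refine ⟨L / g z, by positivity, fun x y hax hxy hyb => ?_⟩
  have hx : x ∈ Icc a b := ⟨hax, hxy.trans hyb⟩
  have hy : y ∈ Icc a b := ⟨hax.trans hxy, hyb⟩
  have h1 := (convex_Icc a b).norm_image_sub_le_of_norm_deriv_le
    (fun w _ => (hg.differentiable one_ne_zero) w) hL hx hy
  rw [Real.norm_eq_abs, Real.norm_eq_abs, abs_of_nonneg (sub_nonneg.2 hxy)] at h1
  have h2 := le_abs_self (g y - g x)
  have h3 : g z ≤ g x := hmin hx
  have h4 : L * (y - x) ≤ L / g z * (y - x) * g x := by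
    have : L * (y - x) = L / g z * (y - x) * g z := by field_simp
    rw [this]
    have : 0 ≤ L / g z * (y - x) := mul_nonneg (by positivity) (sub_nonneg.2 hxy)
    gcongr
  have h5 := Real.add_one_le_exp (L / g z * (y - x))
  have h6 := mul_le_mul_of_nonneg_right h5 (hpos x hx).le
  linarith

/-- On the left of a non-flat local maximum the logarithm of the derivative increases at most
linearly. -/
lemma exists_deriv_le_exp_mul_of_nonflat {F φ : ℝ → ℝ} {c l : ℝ} (hl : 1 < l)
    (hφ : ContDiff ℝ 2 φ) (hφ' : ∀ x, deriv φ x < 0) (hc : φ c = 0)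
    (hF : ∀ᶠ x in nhds c, F x = F c - |φ x| ^ l) :
    ∃ a < c, ∃ C, 0 ≤ C ∧ ∀ x y, a ≤ x → x ≤ y → y < c →
      deriv F y ≤ Real.exp (C * (y - x)) * deriv F x := by
  obtain ⟨ε, hε, hball⟩ := Metric.eventually_nhds_iff_ball.1 hF
  have hd : Differentiable ℝ φ := hφ.differentiable two_ne_zero
  have hanti : StrictAnti φ := strictAnti_of_deriv_neg hφ'
  have hφpos : ∀ x < c, 0 < φ x := fun x hx => hc ▸ hanti hx
  have hderiv : ∀ x, c - ε < x → x < c →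
      deriv F x = φ x ^ (l - 1) * (l * (-deriv φ x)) := by
    intro x hx hxc
    have hev : F =ᶠ[nhds x] fun y => F c - φ y ^ l := by
      filter_upwards [Ioo_mem_nhds hx hxc] with y hy
      rw [hball y (by rw [Metric.mem_ball, Real.dist_eq, abs_lt]; constructor <;>
        linarith [hy.1, hy.2]), abs_of_pos (hφpos y hy.2)]
    have h1 := ((hd x).hasDerivAt.rpow_const (p := l) (Or.inl (hφpos x hxc).ne')).const_sub (F c)
    rw [hev.deriv_eq, h1.deriv]
    ring
  have hg : ContDiff ℝ 1 fun x => - deriv φ x :=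
    ((contDiff_succ_iff_deriv (n := 1)).1 (by rwa [one_add_one_eq_two])).2.2.neg
  obtain ⟨C, hC, hCle⟩ := exists_le_exp_mul hg (a := c - ε) (b := c)
    fun x _ => neg_pos.2 (hφ' x)
  refine ⟨c - ε / 2, by linarith, C, hC, fun x y hx hxy hy => ?_⟩
  rw [hderiv x (by linarith) (by linarith), hderiv y (by linarith) hy]
  have h1 := hCle x y (by linarith) hxy hy.le
  have h2 : φ y ^ (l - 1) ≤ φ x ^ (l - 1) :=
    Real.rpow_le_rpow (hφpos y hy).le (hanti.antitone hxy) (by linarith)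
  have h3 : 0 ≤ φ x ^ (l - 1) := Real.rpow_nonneg (hφpos x (by linarith)).le _
  calc φ y ^ (l - 1) * (l * -deriv φ y)
      ≤ φ x ^ (l - 1) * (l * (Real.exp (C * (y - x)) * -deriv φ x)) := by
        have := (neg_pos.2 (hφ' y)).le
        gcongr
    _ = _ := by ring

namespace BimodData

lemma exists_deriv_le_exp_mul_left (B : BimodData) :
    ∃ a < B.ctp, ∃ C, 0 ≤ C ∧ ∀ x y, a ≤ x → x ≤ y → y < B.ctp →
      deriv B.F y ≤ Real.exp (C * (y - x)) * deriv B.F x := by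
  have hcont : Continuous (deriv B.psip) := B.hpsipC2.continuous_deriv (by norm_num)
  have hsign : (∀ x, deriv B.psip x < 0) ∨ ∀ x, 0 < deriv B.psip x := by
    by_contra! hcon
    obtain ⟨⟨x, hx⟩, y, hy⟩ := hcon
    obtain ⟨z, hz⟩ := mem_range_of_exists_le_of_exists_ge hcont ⟨y, hy⟩ ⟨x, hx⟩
    exact B.hpsipD z hz
  rcases hsign with hs | hs
  · exact exists_deriv_le_exp_mul_of_nonflat B.hlp B.hpsipC2 hs B.hpsip0 B.hpsipEq
  · refine exists_deriv_le_exp_mul_of_nonflat (φ := fun x => -B.psip x) B.hlp B.hpsipC2.neg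
      (fun x => ?_) (by simp [B.hpsip0]) (by simpa using B.hpsipEq)
    simpa using hs x

/-- One-sided bound for the distortion on the increasing branch outside `[c̃⁺, d̃⁺]`. -/
lemma exists_deriv_le_exp_mul (B : BimodData) :
    ∃ C, 0 ≤ C ∧ ∀ (m : ℤ) (x y : ℝ), B.dtp + m ≤ x → x ≤ y → y < B.ctp + 1 + m →
      deriv B.F y ≤ Real.exp (C * (y - x)) * deriv B.F x := by
  obtain ⟨a, ha, C₁, hC₁, h₁⟩ := B.exists_deriv_le_exp_mul_left
  have hg : ContDiff ℝ 1 (deriv B.F) :=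
    ((contDiff_succ_iff_deriv (n := 1)).1 (by rw [one_add_one_eq_two]; exact B.hC2)).2.2
  obtain ⟨C₂, hC₂, h₂⟩ := exists_le_exp_mul hg (a := B.dtp) (b := a + 1) fun x hx =>
    B.hincr x ⟨B.hdtp.1.trans_le hx.1, by linarith [hx.2]⟩
  have hpos : ∀ x, B.dtp ≤ x → x < B.ctp + 1 → 0 < deriv B.F x := fun x hx hx' =>
    B.hincr x ⟨B.hdtp.1.trans_le hx, hx'⟩
  have h₁' : ∀ x y, a + 1 ≤ x → x ≤ y → y < B.ctp + 1 →
      deriv B.F y ≤ Real.exp (C₁ * (y - x)) * deriv B.F x := by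
    intro x y hx hxy hy
    have h := h₁ (x - 1) (y - 1) (by linarith) (by linarith) (by linarith)
    have hx1 := B.deriv_add_int (x - 1) 1
    have hy1 := B.deriv_add_int (y - 1) 1
    simp only [Int.cast_one, sub_add_cancel] at hx1 hy1
    rw [← hx1, ← hy1] at h
    simpa using h
  set C := max C₁ C₂
  have hmono : ∀ D ≤ C, ∀ x y, B.dtp ≤ x → x ≤ y → y < B.ctp + 1 →
      deriv B.F y ≤ Real.exp (D * (y - x)) * deriv B.F x →
      deriv B.F y ≤ Real.exp (C * (y - x)) * deriv B.F x := by
    intro D hD x y hx hxy hy h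
    refine h.trans ?_
    have := (hpos x hx (by linarith)).le
    have := sub_nonneg.2 hxy
    gcongr
  have hmain : ∀ x y, B.dtp ≤ x → x ≤ y → y < B.ctp + 1 →
      deriv B.F y ≤ Real.exp (C * (y - x)) * deriv B.F x := by
    intro x y hx hxy hy
    rcases le_total y (a + 1) with hya | hya
    · exact hmono C₂ (le_max_right _ _) x y hx hxy hy (h₂ x y hx hxy hya)
    rcases le_total (a + 1) x with hxa | hxa
    · exact hmono C₁ (le_max_left _ _) x y hx hxy hy (h₁' x y hxa hxy hy)
    have e1 := hmono C₂ (le_max_right _ _) x (a + 1) hx hxa (by linarith) (h₂ x _ hx hxa le_rfl)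
    have e2 := hmono C₁ (le_max_left _ _) (a + 1) y (by linarith) hya hy
      (h₁' _ y le_rfl hya hy)
    calc deriv B.F y ≤ Real.exp (C * (y - (a + 1))) * deriv B.F (a + 1) := e2
      _ ≤ Real.exp (C * (y - (a + 1))) * (Real.exp (C * (a + 1 - x)) * deriv B.F x) := by gcongr
      _ = Real.exp (C * (y - x)) * deriv B.F x := by
        rw [← mul_assoc, ← Real.exp_add]
        ring_nf
  refine ⟨C, hC₁.trans (le_max_left _ _), fun m x y hx hxy hy => ?_⟩
  have h := hmain (x - m) (y - m) (by linarith) (by linarith) (by linarith)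
  have hxm := B.deriv_add_int (x - m) m
  have hym := B.deriv_add_int (y - m) m
  rw [sub_add_cancel] at hxm hym
  rw [← hxm, ← hym] at h
  simpa using h

/-- The derivative of the `n`-th iterate of the upper map, along orbits outside the plateau. -/
def derivIter (B : BimodData) (n : ℕ) (x : ℝ) : ℝ :=
  ∏ i ∈ Finset.range n, deriv B.F (B.Fp^[i] x)

lemma hasDerivAt_Fp (B : BimodData) {x : ℝ} {m : ℤ} (hx : B.dtp + m < x)
    (hx' : x < B.ctp + 1 + m) : HasDerivAt B.Fp (deriv B.F x) x := by
  refine (B.differentiable x).hasDerivAt.congr_of_eventuallyEq ?_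
  filter_upwards [Ioo_mem_nhds hx hx'] with y hy
  exact B.Fp_eq_of_mem ⟨hy.1.le, hy.2.le⟩

lemma hasDerivAt_iterate (B : BimodData) {x : ℝ} {n : ℕ}
    (hx : ∀ i < n, ∃ m : ℤ, B.dtp + m < B.Fp^[i] x ∧ B.Fp^[i] x < B.ctp + 1 + m) :
    HasDerivAt B.Fp^[n] (B.derivIter n x) x := by
  induction n with
  | zero => simpa [derivIter] using hasDerivAt_id x
  | succ n ih =>
    obtain ⟨m, h1, h2⟩ := hx n (Nat.lt_succ_self n)
    have h := (B.hasDerivAt_Fp h1 h2).comp x (ih fun i hi => hx i (hi.trans (Nat.lt_succ_self n)))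
    rw [Function.iterate_succ', derivIter, Finset.prod_range_succ, mul_comm]
    exact h

lemma deriv_pos_of_gap (B : BimodData) {x : ℝ} {m : ℤ} (hx : B.dtp + m < x)
    (hx' : x < B.ctp + 1 + m) : 0 < deriv B.F x := by
  have h := B.hincr (x - m) ⟨by linarith [B.hdtp.1], by linarith⟩
  have h2 := B.deriv_add_int (x - m) m
  rw [sub_add_cancel] at h2
  rwa [h2]

/-- One-sided distortion bound for iterates of the upper map. -/
lemma derivIter_le (B : BimodData) {C : ℝ} (hC : 0 ≤ C)
    (hdist : ∀ (m : ℤ) (x y : ℝ), B.dtp + m ≤ x → x ≤ y → y < B.ctp + 1 + m →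
      deriv B.F y ≤ Real.exp (C * (y - x)) * deriv B.F x) {s t x y : ℝ} {N : ℕ}
    (hgap : ∀ i < N, ∃ m : ℤ, B.dtp + m < B.Fp^[i] s ∧ B.Fp^[i] t < B.ctp + 1 + m)
    (hsum : ∑ i ∈ Finset.range N, (B.Fp^[i] t - B.Fp^[i] s) ≤ 1)
    (hsx : s ≤ x) (hxy : x ≤ y) (hyt : y ≤ t) :
    B.derivIter N y ≤ Real.exp C * B.derivIter N x := by
  have hmono (i : ℕ) := B.Fp.monotone.iterate i
  have hpos : ∀ z, s ≤ z → z ≤ t → ∀ i ∈ Finset.range N, 0 ≤ deriv B.F (B.Fp^[i] z) := by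
    intro z hz hz' i hi
    obtain ⟨m, h1, h2⟩ := hgap i (by simpa using hi)
    exact (B.deriv_pos_of_gap (h1.trans_le (hmono i hz)) ((hmono i hz').trans_lt h2)).le
  have hstep : B.derivIter N y ≤ ∏ i ∈ Finset.range N,
      (Real.exp (C * (B.Fp^[i] t - B.Fp^[i] s)) * deriv B.F (B.Fp^[i] x)) := by
    refine Finset.prod_le_prod (hpos y (hsx.trans hxy) hyt) fun i hi => ?_
    obtain ⟨m, h1, h2⟩ := hgap i (by simpa using hi)
    have hs := hmono i hsx
    have ht := hmono i hyt
    refine (hdist m _ _ (h1.le.trans hs) (hmono i hxy) (ht.trans_lt h2)).trans ?_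
    have := hpos x hsx (hxy.trans hyt) i hi
    gcongr
  refine hstep.trans ?_
  rw [Finset.prod_mul_distrib, ← Real.exp_sum, ← Finset.mul_sum]
  have : 0 ≤ B.derivIter N x := Finset.prod_nonneg (hpos x hsx (hxy.trans hyt))
  refine mul_le_mul_of_nonneg_right (Real.exp_le_exp.2 ?_) this
  nlinarith

end BimodData

namespace BimodData

variable {B : BimodData} {h : ℝ → ℝ}

lemma map_criticalValue (H : IsRotationSemiconj B.Fp h) :
    h (B.F B.ctp) = h B.ctp + B.rhop := by
  rw [← B.Fp_ctp]
  exact H.map_apply B.ctp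

lemma natCast_mul_rhop_sub_ne_zero (B : BimodData) {j : ℕ} (hj : 1 ≤ j) (m : ℤ) :
    j * B.rhop - m ≠ 0 :=
  (((irrational_natCast_mul_iff).2 ⟨by omega, B.hirrp⟩).sub_intCast m).ne_zero

/-- The plateau has preimages under the iterates of the upper map. -/
lemma exists_plateau_preimage (H : IsRotationSemiconj B.Fp h) (N : ℕ) (p : ℤ) :
    ∃ l r, l < r ∧ B.Fp^[N] l = B.ctp + p ∧ B.Fp^[N] r = B.dtp + p ∧
      h l = h B.ctp + p - N * B.rhop ∧ h r = h l := by
  obtain ⟨l, hl⟩ := B.Fp_surjective.iterate N (B.ctp + p)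
  obtain ⟨r, hr⟩ := B.Fp_surjective.iterate N (B.dtp + p)
  have h1 := H.map_iterate N l
  have h2 := H.map_iterate N r
  rw [hl, H.map_add_int] at h1
  rw [hr, H.map_add_int, map_dtp_eq H] at h2
  refine ⟨l, r, ?_, hl, hr, ?_, by linarith⟩
  · by_contra! hle
    have := B.Fp.monotone.iterate N hle
    rw [hl, hr] at this
    linarith [B.ctp_lt_dtp]
  · rw [rhop]
    linarith

/-- The semiconjugacy does not collapse the interval between the critical values: otherwise this
interval would be wandering, which the one-sided distortion bound excludes. -/
lemma map_lt_map_criticalValue (H : IsRotationSemiconj B.Fp h) :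
    h (B.F B.ctm) < h (B.F B.ctp) := by
  by_contra! hcon
  set u := B.F B.ctm
  set v := B.F B.ctp
  have huv : u < v := B.map_ctm_lt_map_ctp
  have hv : h v = h B.ctp + B.rhop := map_criticalValue H
  have hu : h u = h v := le_antisymm (H.monotone huv.le) hcon
  obtain ⟨C, hC, hdist⟩ := B.exists_deriv_le_exp_mul
  have hsummable : Summable fun n => B.Fp^[n] v - B.Fp^[n] u := by
    refine summable_of_sum_range_le (c := 1)
      (fun n => sub_nonneg.2 (B.Fp.monotone.iterate n huv.le)) fun n => ?_
    refine sum_iterate_sub_le_one H huv.le (hu.trans hv) fun j hj _ m => ?_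
    rw [hu, sub_self, abs_pos]
    exact B.natCast_mul_rhop_sub_ne_zero hj m
  have hcd := sub_pos.2 B.ctp_lt_dtp
  have huv' := sub_pos.2 huv
  obtain ⟨n, hn⟩ := eventually_atTop.1 (hsummable.tendsto_atTop_zero.eventually_lt_const
    (show 0 < (B.dtp - B.ctp) * (v - u) / Real.exp C by positivity))
  set q := cfQ B.rhop (2 * n + 1) with hq
  have hqn : 2 * n + 1 ≤ q := (le_cfQ B.hirrp (2 * n)).2
  have hsmall := hn (q - 1) (by omega)
  set N := q - 1 with hN
  obtain ⟨l, r, hlr, hl, hr, hhl, hhr⟩ := exists_plateau_preimage H N (cfP B.rhop (2 * n + 1))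
  have hE : h l = h v - cfErr B.rhop (2 * n + 1) := by
    have : (N : ℝ) = q - 1 := by rw [hN, Nat.cast_sub (by omega), Nat.cast_one]
    rw [hhl, hv, cfErr, this, ← hq]
    ring
  have hEneg := (cfErr_pos_neg B.hirrp n).2
  change cfErr B.rhop (2 * n + 1) < 0 at hEneg
  have hvl : v < l := H.lt_of_map_lt (by linarith)
  have hrl : r < l + 1 := H.lt_of_map_lt (by rw [H.map_add_one]; linarith)
  have hapx : ∀ j : ℕ, 1 ≤ j → j ≤ N → ∀ m : ℤ, h r - h u < |j * B.rhop - m| := by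
    intro j hj hjN m
    have := abs_cfErr_lt_of_lt_cfQ B.hirrp (2 * n) hj (by change j < q; omega) m
    change |cfErr B.rhop (2 * n + 1)| < |j * B.rhop - m| at this
    rw [abs_of_neg hEneg] at this
    linarith
  have hur : u ≤ r := by linarith
  have hgap : ∀ i < N, ∃ m : ℤ, B.dtp + m < B.Fp^[i] u ∧ B.Fp^[i] r < B.ctp + 1 + m :=
    fun i hi => exists_gap_iterate H hur (hu.trans hv) hapx hi
  have hsum := sum_iterate_sub_le_one H hur (hu.trans hv) hapx
  have hder : ∀ x, u ≤ x → x ≤ r → HasDerivAt B.Fp^[N] (B.derivIter N x) x := by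
    intro x hux hxr
    refine B.hasDerivAt_iterate fun i hi => ?_
    obtain ⟨m, h1, h2⟩ := hgap i hi
    exact ⟨m, h1.trans_le (B.Fp.monotone.iterate i hux),
      (B.Fp.monotone.iterate i hxr).trans_lt h2⟩
  have hcont : Continuous B.Fp^[N] := B.Fp_continuous.iterate N
  obtain ⟨x, hx, hxd⟩ := exists_hasDerivAt_eq_slope B.Fp^[N] (B.derivIter N) huv
    hcont.continuousOn fun x hx => hder x hx.1.le (by linarith [hx.2])
  obtain ⟨y, hy, hyd⟩ := exists_hasDerivAt_eq_slope B.Fp^[N] (B.derivIter N) hlr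
    hcont.continuousOn fun y hy => hder y (by linarith [hy.1]) hy.2.le
  have hle := B.derivIter_le hC hdist hgap hsum hx.1.le (by linarith [hx.2, hy.1]) hy.2.le
  rw [hxd, hyd, hl, hr, add_sub_add_right_eq_sub] at hle
  have hlr' : B.dtp - B.ctp ≤ (B.dtp - B.ctp) / (r - l) := by
    rw [le_div_iff₀ (by linarith)]
    nlinarith
  rw [lt_div_iff₀ (Real.exp_pos C)] at hsmall
  have := hlr'.trans hle
  rw [mul_div_assoc', le_div_iff₀ huv'] at this
  linarith

/-- Off the translates of `[c̃⁺, d̃⁺]` the orbits of `F` and of the upper map agree. -/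
lemma iterate_eq_of_avoid {z : ℝ} {N : ℕ}
    (hz : ∀ i < N, ∀ m : ℤ, B.Fp^[i] z ∉ Icc (B.ctp + m) (B.dtp + m)) {i : ℕ} (hi : i ≤ N) :
    B.F^[i] z = B.Fp^[i] z := by
  induction i with
  | zero => rfl
  | succ i ih =>
    rw [Function.iterate_succ_apply', Function.iterate_succ_apply', ih (by omega)]
    obtain ⟨m, h1, h2⟩ := B.exists_gap (le_refl (B.Fp^[i] z)) fun w hw m => by
      rw [Icc_self, mem_singleton_iff] at hw
      rw [hw]
      exact hz i hi m
    exact (B.Fp_eq_of_mem ⟨h1.le, h2.le⟩).symm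

lemma iterate_coe (B : BimodData) (n : ℕ) (x : ℝ) :
    B.f^[n] (x : UnitAddCircle) = ((B.F^[n] x : ℝ) : UnitAddCircle) :=
  (Function.Semiconj.iterate_right (f := fun x : ℝ => (x : UnitAddCircle))
    (fun x => (B.hf x).symm) n x).symm

lemma exists_mem_Icc_of_coe_mem_IIp {x : ℝ} (hx : (x : UnitAddCircle) ∈ B.IIp) :
    ∃ m : ℤ, x ∈ Icc (B.ctp + m) (B.dtp + m) := by
  obtain ⟨y, hy, hyx⟩ := hx
  have hsub : ((x - y : ℝ) : UnitAddCircle) = 0 := by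
    rw [AddCircle.coe_sub, ← hyx, sub_self]
  obtain ⟨m, hm⟩ := (AddCircle.coe_eq_zero_iff (1 : ℝ)).1 hsub
  rw [zsmul_eq_mul, mul_one] at hm
  exact ⟨m, by linarith [hy.1], by linarith [hy.2]⟩

/-- If the error `q ρ⁺ - p` is positive and small, the plateau contains a point which returns to
itself exactly after `q` iterates. -/
lemma exists_periodic (H : IsRotationSemiconj B.Fp h) {q : ℕ} (hq : 1 ≤ q) {p : ℤ}
    (hpos : 0 < q * B.rhop - p)
    (hlt : q * B.rhop - p < h (B.F B.ctp) - h (B.F B.ctm)) :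
    ∃ b ∈ B.IIp, B.f^[q] b = b ∧ ∀ n : ℕ, 1 ≤ n → n < q → B.f^[n] b ∉ B.IIp := by
  obtain ⟨N, rfl⟩ : ∃ N, q = N + 1 := ⟨q - 1, by omega⟩
  have hv := map_criticalValue H
  obtain ⟨l, r, hlr, hl, hr, hhl, hhr⟩ := exists_plateau_preimage H N p
  push_cast at hpos hlt
  have hul : B.F B.ctm < l := H.lt_of_map_lt (by linarith)
  have hrv : r < B.F B.ctp := H.lt_of_map_lt (by linarith)
  have havoid : ∀ z ∈ Icc l r, ∀ i < N, ∀ m : ℤ,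
      B.Fp^[i] z ∉ Icc (B.ctp + m) (B.dtp + m) := by
    intro z hz i hi m hmem
    have h1 := map_eq_of_mem H hmem
    have h2 := H.monotone hz.1
    have h3 := H.monotone hz.2
    rw [H.map_iterate] at h1
    refine B.natCast_mul_rhop_sub_ne_zero (j := N - i) (by omega) (p - m) ?_
    rw [Nat.cast_sub hi.le]
    push_cast
    rw [rhop] at *
    linarith
  have hcont : Continuous B.F := B.differentiable.continuous
  have hsub := intermediate_value_Icc B.hdtp.1.le (f := B.F) hcont.continuousOn
  rw [B.hdtpF] at hsub
  obtain ⟨s, hs, hsl⟩ := hsub (show l ∈ Icc (B.F B.ctm) (B.F B.ctp) from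
    ⟨hul.le, by linarith⟩)
  obtain ⟨t, ht, htr⟩ := hsub (show r ∈ Icc (B.F B.ctm) (B.F B.ctp) from
    ⟨by linarith, hrv.le⟩)
  have hmono : StrictMonoOn B.F (Icc B.ctm B.dtp) :=
    B.strictMonoOn.mono (Icc_subset_Icc_right B.hdtp.2.le)
  have hst : s ≤ t := (hmono.le_iff_le hs ht).1 (by rw [hsl, htr]; exact hlr.le)
  have hFs : B.F^[N + 1] s = B.ctp + p := by
    rw [Function.iterate_succ_apply, hsl,
      iterate_eq_of_avoid (havoid l (left_mem_Icc.2 hlr.le)) le_rfl, hl]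
  have hFt : B.F^[N + 1] t = B.dtp + p := by
    rw [Function.iterate_succ_apply, htr,
      iterate_eq_of_avoid (havoid r (right_mem_Icc.2 hlr.le)) le_rfl, hr]
  obtain ⟨b, hb, hb0⟩ := intermediate_value_Icc hst (f := fun x => B.F^[N + 1] x - x)
    ((hcont.iterate (N + 1)).sub continuous_id).continuousOn
    (show (p : ℝ) ∈ _ by
      simp only [hFs, hFt]
      exact ⟨by linarith [hs.1, B.h1], by linarith [ht.2]⟩)
  have hbI : b ∈ Icc B.ctm B.dtp := ⟨hs.1.trans hb.1, hb.2.trans ht.2⟩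
  have hFb : B.F b ∈ Icc l r := by
    rw [← hsl, ← htr]
    exact ⟨hmono.monotoneOn hs hbI hb.1, hmono.monotoneOn hbI ht hb.2⟩
  refine ⟨b, ⟨b, ⟨B.h1.le.trans hbI.1, hbI.2⟩, rfl⟩, ?_, fun n hn hnq hmem => ?_⟩
  · rw [B.iterate_coe, show B.F^[N + 1] b = b + p by linarith]
    simp
  · obtain ⟨n, rfl⟩ : ∃ n', n = n' + 1 := ⟨n - 1, by omega⟩
    rw [B.iterate_coe] at hmem
    obtain ⟨m, hm⟩ := exists_mem_Icc_of_coe_mem_IIp hmem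
    rw [Function.iterate_succ_apply, iterate_eq_of_avoid (havoid _ hFb) (by omega)] at hm
    exact havoid _ hFb n (by omega) m hm

end BimodData

/-- **Lemma (periodic approximation of the critical orbit).** For every sufficiently
large `k` there exists `b⁺ ∈ 𝕀⁺` periodic for `f` of period `q⁺_{2k}`, whose iterates
`f^n(b⁺)` for `1 ≤ n < q⁺_{2k}` avoid `𝕀⁺`. -/
theorem periodic_approximation (B : BimodData) :
    ∀ᶠ k : ℕ in atTop, ∃ b ∈ B.IIp,
      B.f^[cfQ B.rhop (2 * k)] b = b ∧
      ∀ n : ℕ, 1 ≤ n → n < cfQ B.rhop (2 * k) → B.f^[n] b ∉ B.IIp := by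
  obtain ⟨h, H⟩ := exists_isRotationSemiconj B.Fp
  have hgap := sub_pos.2 (BimodData.map_lt_map_criticalValue H)
  filter_upwards [(tendsto_one_div_add_atTop_nhds_zero_nat (𝕜 := ℝ)).eventually_lt_const hgap]
    with k hk
  exact BimodData.exists_periodic H (cfQ_pos B.hirrp (2 * k)).1 (p := cfP B.rhop (2 * k))
    (cfErr_pos_neg B.hirrp k).1 ((cfErr_even_le B.hirrp k).trans_lt hk)
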